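/- The polyiamond T₃,₁ = {(0,0,0),(0,0,1),(1,0,0)} has threshold sequence (1,5,∞): it is a (1,1)-winner, a (1,2)-loser, a (2,5)-winner, a (2,6)-loser, and an (n,b)-winner for every n ≥ 3 and every b ∈ ℕ. -/

import Mathlib

/-- Cells of the triangular board: `(x, y, u)` with `u = 0` an upward triangle
and `u = 1` a downward triangle. -/
abbrev TriCell : Type := ℤ × ℤ × Fin 2

/-- The downward cell `(x,y,1)` is adjacent exactly to the upward cells
`(x,y,0)`, `(x+1,y,0)` and `(x,y+1,0)`. -/
def TriAdjacent (p q : TriCell) : Prop :=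
  ∃ x y : ℤ,
    (p = (x, y, 1) ∧ (q = (x, y, 0) ∨ q = (x + 1, y, 0) ∨ q = (x, y + 1, 0))) ∨
    (q = (x, y, 1) ∧ (p = (x, y, 0) ∨ p = (x + 1, y, 0) ∨ p = (x, y + 1, 0)))

/-- A polyiamond is a finite nonempty set of cells that is connected under adjacency. -/
def IsPolyiamond (A : Finset TriCell) : Prop :=
  A.Nonempty ∧ ∀ p ∈ A, ∀ q ∈ A,
    Relation.ReflTransGen (fun u v => u ∈ A ∧ v ∈ A ∧ TriAdjacent u v) p q

/-- Rotation of the triangular tiling by 60 degrees about a vertex,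
expressed in these coordinates. -/
def triRot : Function.End TriCell := fun p =>
  if p.2.2 = 0 then (-p.2.1 - 1, p.1 + p.2.1, 1) else (-p.2.1 - 1, p.1 + p.2.1 + 1, 0)

/-- A reflection of the triangular tiling, expressed in these coordinates. -/
def triRefl : Function.End TriCell := fun p => (p.2.1, p.1, p.2.2)

/-- Translations of the triangular tiling. -/
def IsTriTranslation (f : Function.End TriCell) : Prop :=
  ∃ a b : ℤ, f = fun p => (p.1 + a, p.2.1 + b, p.2.2)

/-- The symmetries of the triangular tiling: all compositions of translations,
rotations by multiples of 60 degrees and reflections.  (Since `triRot` has order 6,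
`triRefl` has order 2, and the set of translations is closed under inverses, the
monoid generated by them is the full symmetry group.) -/
def triSymmetries : Submonoid (Function.End TriCell) :=
  Submonoid.closure ({f | IsTriTranslation f} ∪ {triRot, triRefl})

/-- `P` is a placement of the polyiamond `A`: the image of `A` under a symmetry
of the triangular tiling. -/
def IsTriPlacement (A : Finset TriCell) (P : Set TriCell) : Prop :=
  ∃ f ∈ triSymmetries, P = (f : TriCell → TriCell) '' (↑A : Set TriCell)

/-- The maker's move on his `n`-th turn (`0`-indexed), given his strategy `σ`
(a function of the list of the breaker's previous moves, which together with `σ`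
determines the whole history) and the breaker's sequence of moves `β`. -/
def makerMove (σ : List (Finset TriCell) → Finset TriCell) (β : ℕ → Finset TriCell)
    (n : ℕ) : Finset TriCell :=
  σ ((List.range n).map β)

/-- The set of cells marked by the maker after his first `n` turns. -/
def makerMarks (σ : List (Finset TriCell) → Finset TriCell) (β : ℕ → Finset TriCell) :
    ℕ → Finset TriCell
  | 0 => ∅
  | n + 1 => makerMarks σ β n ∪ makerMove σ β n

/-- The set of cells marked by the breaker after her first `n` turns. -/
def breakerMarks (β : ℕ → Finset TriCell) : ℕ → Finset TriCell
  | 0 => ∅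
  | n + 1 => breakerMarks β n ∪ β n

/-- The maker plays legally: on every turn he marks exactly `a` previously unmarked cells. -/
def MakerLegal (a : ℕ) (σ : List (Finset TriCell) → Finset TriCell)
    (β : ℕ → Finset TriCell) : Prop :=
  ∀ n, (makerMove σ β n).card = a ∧
    Disjoint (makerMove σ β n) (makerMarks σ β n ∪ breakerMarks β n)

/-- The breaker plays legally: on every turn she marks exactly `b` previously unmarked
cells (on turn `n` she moves after the maker, so she must avoid `makerMarks σ β (n+1)`). -/
def BreakerLegal (b : ℕ) (σ : List (Finset TriCell) → Finset TriCell)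
    (β : ℕ → Finset TriCell) : Prop :=
  ∀ n, (β n).card = b ∧ Disjoint (β n) (makerMarks σ β (n + 1) ∪ breakerMarks β n)

/-- `A` is an `(a,b)`-winner: the maker has a winning strategy in the weak `(a,b)`
achievement game with goal `A`, i.e. a strategy that always plays legally against any
legal breaker play and eventually marks all cells of some placement of `A`. -/
def IsWinner (A : Finset TriCell) (a b : ℕ) : Prop :=
  ∃ σ : List (Finset TriCell) → Finset TriCell, ∀ β : ℕ → Finset TriCell,
    BreakerLegal b σ β →
      MakerLegal a σ β ∧
        ∃ n, ∃ P : Set TriCell, IsTriPlacement A P ∧ P ⊆ ↑(makerMarks σ β n)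

/-- The polyiamond `T₃,₁`. -/
def T31 : Finset TriCell := {(0, 0, 0), (0, 0, 1), (1, 0, 0)}

lemma t31_ext (D X : Finset TriCell) (a : ℕ) (h : D.card ≤ a) (hd : Disjoint D X) :
    ∃ S, D ⊆ S ∧ S.card = a ∧ Disjoint S X := by
  obtain ⟨t, ht, hc⟩ := Infinite.exists_superset_card_eq (D ∪ X) (a + X.card)
    (by rw [Finset.card_union_of_disjoint hd]; omega)
  refine ⟨t \ X, ?_, ?_, Finset.sdiff_disjoint⟩
  · intro x hx
    exact Finset.mem_sdiff.2 ⟨ht (Finset.mem_union_left _ hx), Finset.disjoint_left.1 hd hx⟩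
  · rw [Finset.card_sdiff_of_subset (Finset.subset_union_right.trans ht)]; omega

def HasT31 (M : Finset TriCell) : Prop :=
  ∃ P : Set TriCell, IsTriPlacement T31 P ∧ P ⊆ ↑M

def WinIn (a b : ℕ) : ℕ → Finset TriCell → Finset TriCell → Prop
  | 0, M, _ => HasT31 M
  | k + 1, M, B => ∃ S : Finset TriCell, S.card = a ∧ Disjoint S (M ∪ B) ∧
      ∀ T : Finset TriCell, T.card = b → Disjoint T ((M ∪ S) ∪ B) → WinIn a b k (M ∪ S) (B ∪ T)

lemma winner_of_winIn (a b k : ℕ) (h : WinIn a b k ∅ ∅) : IsWinner T31 a b := by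
  have key : ∀ (n : ℕ) (M B : Finset TriCell), ∃ S : Finset TriCell, S.card = a ∧
      Disjoint S (M ∪ B) ∧ ∀ j, k - n = j + 1 → WinIn a b (j + 1) M B →
      ∀ T : Finset TriCell, T.card = b → Disjoint T ((M ∪ S) ∪ B) →
        WinIn a b j (M ∪ S) (B ∪ T) := by
    intro n M B
    by_cases hw : ∃ j, k - n = j + 1 ∧ WinIn a b (j + 1) M B
    · obtain ⟨j, hj, S, h1, h2, h3⟩ := hw
      refine ⟨S, h1, h2, fun j' hj' _ => ?_⟩
      obtain rfl : j' = j := by omega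
      exact h3
    · obtain ⟨S, -, h1, h2⟩ := t31_ext ∅ (M ∪ B) a (by simp) (by simp)
      exact ⟨S, h1, h2, fun j hj hw' => absurd ⟨j, hj, hw'⟩ hw⟩
  choose f hf1 hf2 hf3 using key
  let st : List (Finset TriCell) → ℕ × Finset TriCell × Finset TriCell := fun l =>
    l.foldl (fun s T => (s.1 + 1, s.2.1 ∪ f s.1 s.2.1 s.2.2, s.2.2 ∪ T)) (0, ∅, ∅)
  let σ : List (Finset TriCell) → Finset TriCell := fun l => f (st l).1 (st l).2.1 (st l).2.2
  refine ⟨σ, fun β hβ => ?_⟩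
  have hst : ∀ n, st ((List.range n).map β) = (n, makerMarks σ β n, breakerMarks β n) := by
    intro n
    induction n with
    | zero => simp [st, makerMarks, breakerMarks]
    | succ n ih =>
      have e : st ((List.range (n + 1)).map β) =
          ((st ((List.range n).map β)).1 + 1,
            (st ((List.range n).map β)).2.1 ∪ σ ((List.range n).map β),
            (st ((List.range n).map β)).2.2 ∪ β n) := by
        simp only [st, σ, List.range_succ, List.map_append, List.foldl_append, List.map_cons,
          List.map_nil, List.foldl_cons, List.foldl_nil]
      rw [e, ih]
      rfl
  have hmv : ∀ n, makerMove σ β n = f n (makerMarks σ β n) (breakerMarks β n) := by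
    intro n
    show f _ _ _ = _
    rw [hst n]
  refine ⟨fun n => ?_, k, ?_⟩
  · rw [hmv]; exact ⟨hf1 _ _ _, hf2 _ _ _⟩
  · have : ∀ n, n ≤ k → WinIn a b (k - n) (makerMarks σ β n) (breakerMarks β n) := by
      intro n
      induction n with
      | zero => intro _; exact h
      | succ n ih =>
        intro hn
        have h1 := ih (by omega)
        have e : k - n = (k - (n + 1)) + 1 := by omega
        rw [e] at h1
        have h2 := hf3 n _ _ _ e h1 (β n) (hβ n).1
        rw [← hmv] at h2
        exact h2 (hβ n).2
    have h0 := this k le_rfl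
    rw [Nat.sub_self] at h0
    exact h0

lemma hasT31_of {M : Finset TriCell} (f : Function.End TriCell) (hf : f ∈ triSymmetries)
    (x y : ℤ) (h : ∀ p ∈ T31, ((f p).1 + x, (f p).2.1 + y, (f p).2.2) ∈ M) : HasT31 M := by
  refine ⟨_, ⟨HMul.hMul (α := Function.End TriCell)
    (fun p => (p.1 + x, p.2.1 + y, p.2.2)) f,
    mul_mem (Submonoid.subset_closure (Or.inl ⟨x, y, rfl⟩)) hf, rfl⟩, ?_⟩
  rintro _ ⟨p, hp, rfl⟩
  exact h p hp

lemma rot_mem : triRot ∈ triSymmetries := Submonoid.subset_closure (Or.inr (Or.inl rfl))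
lemma refl_mem : triRefl ∈ triSymmetries := Submonoid.subset_closure (Or.inr (Or.inr rfl))

lemma pl1 {M : Finset TriCell} (x y : ℤ) (h1 : ((x, y, 1) : TriCell) ∈ M)
    (h2 : ((x, y, 0) : TriCell) ∈ M) (h3 : ((x + 1, y, 0) : TriCell) ∈ M) : HasT31 M := by
  apply hasT31_of 1 (one_mem _) x y
  simp [T31, h1, h2, add_comm 1 x, h3, Function.End.one_def]

lemma pl2 {M : Finset TriCell} (x y : ℤ) (h1 : ((x, y, 1) : TriCell) ∈ M)
    (h2 : ((x, y, 0) : TriCell) ∈ M) (h3 : ((x, y + 1, 0) : TriCell) ∈ M) : HasT31 M := by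
  apply hasT31_of triRefl refl_mem x y
  simp [T31, h1, h2, add_comm 1 y, h3, triRefl]

lemma pl3 {M : Finset TriCell} (x y : ℤ) (h1 : ((x, y, 1) : TriCell) ∈ M)
    (h2 : ((x + 1, y, 0) : TriCell) ∈ M) (h3 : ((x, y + 1, 0) : TriCell) ∈ M) : HasT31 M := by
  apply hasT31_of (triRot * triRot) (mul_mem rot_mem rot_mem) (x + 2) y
  have hc : ∀ p, (triRot * triRot : Function.End TriCell) p = triRot (triRot p) := fun _ => rfl
  have e1 : -1 + (x + 2) = x + 1 := by ring
  have e2 : -1 - 1 + (x + 2) = x := by ring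
  simp [T31, h1, h2, add_comm 1 y, h3, hc, triRot, e1, e2]

lemma pl4 {M : Finset TriCell} (x y : ℤ) (h1 : ((x, y, 0) : TriCell) ∈ M)
    (h2 : ((x, y - 1, 1) : TriCell) ∈ M) (h3 : ((x, y, 1) : TriCell) ∈ M) : HasT31 M := by
  apply hasT31_of triRot rot_mem (x + 1) (y - 1)
  simp [T31, h1, h2, h3, triRot]

lemma win_n (n b : ℕ) (hn : 3 ≤ n) : IsWinner T31 n b := by
  apply winner_of_winIn n b 1
  obtain ⟨S, h1, h2, h3⟩ := t31_ext T31 ∅ n (by simpa [T31] using hn) (by simp)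
  refine ⟨S, h2, by simpa using h3, fun T _ _ => ?_⟩
  apply pl1 0 0 <;> apply Finset.mem_union_right <;> apply h1 <;> simp [T31]

lemma win_25 : IsWinner T31 2 5 := by
  apply winner_of_winIn 2 5 2
  refine ⟨{(0, 0, 0), (10, 0, 0)}, by decide, by simp, fun T hT hd => ?_⟩
  let g : Fin 6 → TriCell × TriCell :=
    ![((0,0,1),(1,0,0)), ((-1,0,1),(-1,0,0)), ((0,-1,1),(0,-1,0)),
      ((10,0,1),(11,0,0)), ((9,0,1),(9,0,0)), ((10,-1,1),(10,-1,0))]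
  have hex : ∃ i, (g i).1 ∉ T ∧ (g i).2 ∉ T := by
    by_contra hcon
    push Not at hcon
    have : ∀ i, ∃ c ∈ T, c = (g i).1 ∨ c = (g i).2 := by
      intro i
      by_cases h : (g i).1 ∈ T
      · exact ⟨_, h, Or.inl rfl⟩
      · exact ⟨_, hcon i h, Or.inr rfl⟩
    choose c hc hc' using this
    have inj : Function.Injective c := by
      have hg : ∀ i j, i ≠ j → (g i).1 ≠ (g j).1 ∧ (g i).1 ≠ (g j).2 ∧
        (g i).2 ≠ (g j).1 ∧ (g i).2 ≠ (g j).2 := by decide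
      intro i j hij
      by_contra hne
      obtain ⟨a1, a2, a3, a4⟩ := hg i j hne
      rcases hc' i with h | h <;> rcases hc' j with h' | h' <;> rw [h, h'] at hij <;> contradiction
    have := Finset.card_le_card_of_injOn (s := Finset.univ) (t := T) c (fun i _ => hc i)
      inj.injOn
    simp [hT] at this
  obtain ⟨i, hi1, hi2⟩ := hex
  refine ⟨{(g i).1, (g i).2}, ?_, ?_, fun T' _ _ => ?_⟩
  · clear hi1 hi2; revert i; decide
  · have : ∀ i, Disjoint ({(g i).1, (g i).2} : Finset TriCell) {(0, 0, 0), (10, 0, 0)} := by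
      decide
    simp only [Finset.empty_union, Finset.disjoint_union_right]
    refine ⟨this i, ?_⟩
    simp [hi1, hi2]
  · show HasT31 _
    fin_cases i
    · apply pl1 0 0 <;> simp [g]
    · apply pl1 (-1) 0 <;> simp [g]
    · apply pl2 0 (-1) <;> simp [g]
    · apply pl1 10 0 <;> simp [g]
    · apply pl1 9 0 <;> simp [g]
    · apply pl2 10 (-1) <;> simp [g]

lemma winIn_one {M B : Finset TriCell} (c : TriCell) (h1 : c ∉ M) (h2 : c ∉ B)
    (h : HasT31 (M ∪ {c})) : WinIn 1 1 1 M B :=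
  ⟨{c}, by simp, by simp [h1, h2], fun _ _ _ => h⟩

lemma win_11 : IsWinner T31 1 1 := by
  apply winner_of_winIn 1 1 3
  refine ⟨{(0, 0, 0)}, by decide, by simp, fun T hT hd => ?_⟩
  obtain ⟨t, rfl⟩ := Finset.card_eq_one.1 hT
  by_cases ht : t = (0, 0, 1)
  · subst ht
    refine ⟨{(0, -1, 1)}, by decide, by decide, fun T hT hd => ?_⟩
    obtain ⟨t, rfl⟩ := Finset.card_eq_one.1 hT
    by_cases ht : t = (0, -1, 0)
    · subst ht
      apply winIn_one (1, -1, 0) (by decide) (by decide)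
      apply pl3 0 (-1) <;> simp
    · apply winIn_one (0, -1, 0) (by decide) (by simpa using fun h => ht h.symm)
      apply pl2 0 (-1) <;> simp
  · refine ⟨{(0, 0, 1)}, by decide, by simpa using fun h => ht h.symm, fun T hT hd => ?_⟩
    obtain ⟨s, rfl⟩ := Finset.card_eq_one.1 hT
    by_cases h1 : (1, 0, 0) ≠ t ∧ (1, 0, 0) ≠ s
    · apply winIn_one (1, 0, 0) (by decide) (by simpa using h1)
      apply pl1 0 0 <;> simp
    by_cases h2 : (0, 1, 0) ≠ t ∧ (0, 1, 0) ≠ s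
    · apply winIn_one (0, 1, 0) (by decide) (by simpa using h2)
      apply pl2 0 0 <;> simp
    have h3 : (0, -1, 1) ≠ t ∧ (0, -1, 1) ≠ s := by
      have a : ((1, 0, 0) : TriCell) = t ∨ ((1, 0, 0) : TriCell) = s := by tauto
      have b : ((0, 1, 0) : TriCell) = t ∨ ((0, 1, 0) : TriCell) = s := by tauto
      rcases a with rfl | rfl <;> rcases b with h | h <;>
        first | exact absurd h (by decide) | (subst h; decide)
    apply winIn_one (0, -1, 1) (by decide) (by simpa using h3)
    apply pl4 0 0 <;> simp

/-! ### Losers -/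

def triNbr (p : TriCell) : Finset TriCell :=
  if p.2.2 = 0 then {(p.1, p.2.1, 1), (p.1 - 1, p.2.1, 1), (p.1, p.2.1 - 1, 1)}
  else {(p.1, p.2.1, 0), (p.1 + 1, p.2.1, 0), (p.1, p.2.1 + 1, 0)}

def triNbr2 (p : TriCell) : Finset TriCell :=
  if p.2.2 = 0 then {(p.1 - 1, p.2.1, 1), (p.1, p.2.1 - 1, 1)}
  else {(p.1 + 1, p.2.1, 0), (p.1, p.2.1 + 1, 0)}

lemma triNbr_rot (p q : TriCell) (h : q ∈ triNbr p) : triRot q ∈ triNbr (triRot p) := by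
  obtain ⟨x, y, u⟩ := p
  fin_cases u <;> simp [triNbr] at h <;> rcases h with rfl | rfl | rfl <;>
    simp [triNbr, triRot] <;> omega

lemma triNbr_refl (p q : TriCell) (h : q ∈ triNbr p) : triRefl q ∈ triNbr (triRefl p) := by
  obtain ⟨x, y, u⟩ := p
  fin_cases u <;> simp [triNbr] at h <;> rcases h with rfl | rfl | rfl <;>
    simp [triNbr, triRefl]

lemma sym_props (f : Function.End TriCell) (hf : f ∈ triSymmetries) :
    (∀ p q, q ∈ triNbr p → f q ∈ triNbr (f p)) ∧ Function.Injective f := by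
  induction hf using Submonoid.closure_induction with
  | mem f hf =>
    rcases hf with ⟨a, b, rfl⟩ | rfl | rfl
    · constructor
      · rintro ⟨x, y, u⟩ q h
        fin_cases u <;> simp [triNbr] at h <;> rcases h with rfl | rfl | rfl <;>
          simp [triNbr] <;> omega
      · rintro ⟨x, y, u⟩ ⟨x', y', u'⟩ h
        simpa using h
    · refine ⟨triNbr_rot, ?_⟩
      rintro ⟨x, y, u⟩ ⟨x', y', u'⟩ h
      fin_cases u <;> fin_cases u' <;> simp [triRot] at h ⊢ <;> omega
    · refine ⟨triNbr_refl, ?_⟩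
      rintro ⟨x, y, u⟩ ⟨x', y', u'⟩ h
      simp [triRefl] at h ⊢
      tauto
  | one => exact ⟨fun _ _ h => h, fun _ _ h => h⟩
  | mul f g _ _ hf hg =>
    exact ⟨fun p q h => hf.1 _ _ (hg.1 _ _ h), hf.2.comp hg.2⟩

lemma hasT31_elim {M : Finset TriCell} (h : HasT31 M) :
    ∃ c p q, c ∈ M ∧ p ∈ M ∧ q ∈ M ∧ p ≠ q ∧ p ∈ triNbr c ∧ q ∈ triNbr c := by
  obtain ⟨P, ⟨f, hf, rfl⟩, hP⟩ := h
  obtain ⟨h1, h2⟩ := sym_props f hf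
  refine ⟨f (0, 0, 1), f (0, 0, 0), f (1, 0, 0), hP ⟨_, by simp [T31], rfl⟩,
    hP ⟨_, by simp [T31], rfl⟩, hP ⟨_, by simp [T31], rfl⟩, fun h => ?_,
    h1 _ _ (by decide), h1 _ _ (by decide)⟩
  have := h2 h
  exact absurd this (by decide)

lemma exists_rec {X : Type} [Inhabited X] (G : ℕ → (ℕ → X) → X)
    (hG : ∀ n β β', (∀ i < n, β i = β' i) → G n β = G n β') :
    ∃ β : ℕ → X, ∀ n, β n = G n β := by
  let L : ℕ → ℕ → X := fun m => Nat.rec (fun _ => default)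
    (fun n Ln => Function.update Ln n (G n Ln)) m
  have hL : ∀ n, L (n + 1) = Function.update (L n) n (G n (L n)) := fun _ => rfl
  have hst : ∀ m i, i < m → L m i = L (i + 1) i := by
    intro m
    induction m with
    | zero => intro i h; omega
    | succ m ih =>
      intro i hi
      by_cases h : i = m
      · subst h; rfl
      · rw [hL m, Function.update_of_ne h, ih i (by omega)]
  refine ⟨fun n => L (n + 1) n, fun n => ?_⟩
  simp only
  rw [hL, Function.update_self]
  exact hG _ _ _ fun i hi => hst n i hi

lemma move_congr (σ : List (Finset TriCell) → Finset TriCell) (β β' : ℕ → Finset TriCell)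
    (n : ℕ) (h : ∀ i < n, β i = β' i) : makerMove σ β n = makerMove σ β' n := by
  unfold makerMove
  congr 1
  apply List.map_congr_left
  intro i hi
  exact h i (List.mem_range.1 hi)

lemma marks_congr (σ : List (Finset TriCell) → Finset TriCell) (β β' : ℕ → Finset TriCell)
    (n : ℕ) (h : ∀ i < n, β i = β' i) : makerMarks σ β n = makerMarks σ β' n := by
  induction n with
  | zero => rfl
  | succ n ih =>
    simp only [makerMarks]
    rw [ih fun i hi => h i (by omega), move_congr σ β β' n fun i hi => h i (by omega)]

lemma bmarks_congr (β β' : ℕ → Finset TriCell)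
    (n : ℕ) (h : ∀ i < n, β i = β' i) : breakerMarks β n = breakerMarks β' n := by
  induction n with
  | zero => rfl
  | succ n ih =>
    simp only [breakerMarks]
    rw [ih fun i hi => h i (by omega), h n (by omega)]

lemma loser_core (a b d : ℕ) (hab : a * d ≤ b) (N : TriCell → Finset TriCell)
    (hN : ∀ v, (N v).card ≤ d) (hs : ∀ v w, w ∈ N v → v ∈ N w) (hw : IsWinner T31 a b) :
    ∃ (m : ℕ → Finset TriCell) (M : Finset TriCell), HasT31 M ∧ (∀ n, (m n).card = a) ∧
      (∀ i j v, v ∈ m i → v ∈ m j → i = j) ∧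
      ∀ v w, v ∈ M → w ∈ M → w ∈ N v → ∃ k, v ∈ m k ∧ w ∈ m k := by
  obtain ⟨σ, hσ⟩ := hw
  have key : ∀ X S : Finset TriCell, ∃ T : Finset TriCell, T.card = b ∧ Disjoint T X ∧
      (S.card = a → S.biUnion N ⊆ X ∪ T) := by
    intro X S
    by_cases hS : S.card = a
    · obtain ⟨T, h1, h2, h3⟩ := t31_ext (S.biUnion N \ X) X b
        ((Finset.card_le_card Finset.sdiff_subset).trans
          ((Finset.card_biUnion_le_card_mul S N d fun v _ => hN v).trans (by rw [hS]; exact hab)))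
        Finset.sdiff_disjoint
      refine ⟨T, h2, h3, fun _ v hv => ?_⟩
      by_cases hx : v ∈ X
      · exact Finset.mem_union_left _ hx
      · exact Finset.mem_union_right _ (h1 (Finset.mem_sdiff.2 ⟨hv, hx⟩))
    · obtain ⟨T, -, h2, h3⟩ := t31_ext ∅ X b (by simp) (by simp)
      exact ⟨T, h2, h3, fun h => absurd h hS⟩
  choose r hr1 hr2 hr3 using key
  obtain ⟨β, hβ⟩ := exists_rec (fun n β => r (makerMarks σ β (n + 1) ∪ breakerMarks β n)
    (makerMove σ β n)) (by
      intro n β β' h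
      simp only [makerMarks]
      rw [marks_congr σ β β' n h, move_congr σ β β' n h, bmarks_congr β β' n h])
  have hleg : BreakerLegal b σ β := by
    intro n
    rw [hβ n]
    exact ⟨hr1 _ _, hr2 _ _⟩
  obtain ⟨hm, n, hP⟩ := hσ β hleg
  have hmono : ∀ j i, i < j → makerMove σ β i ⊆ makerMarks σ β j := by
    intro j
    induction j with
    | zero => intro i h; omega
    | succ j ih =>
      intro i hi
      simp only [makerMarks]
      by_cases h : i = j
      · subst h; exact Finset.subset_union_right
      · exact (ih i (by omega)).trans Finset.subset_union_left
  have hdis : ∀ i j v, i < j → v ∈ makerMove σ β i → v ∉ makerMove σ β j := by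
    intro i j v hij hi hj
    exact Finset.disjoint_left.1 (hm j).2 hj (Finset.mem_union_left _ (hmono j i hij hi))
  have hclosed : ∀ n v, v ∈ makerMarks σ β n → N v ⊆ makerMarks σ β n ∪ breakerMarks β n := by
    intro n
    induction n with
    | zero => intro v hv; simp [makerMarks] at hv
    | succ n ih =>
      intro v hv w hw
      simp only [makerMarks, breakerMarks, Finset.mem_union] at hv ⊢
      rcases hv with hv | hv
      · have := ih v hv hw
        rw [Finset.mem_union] at this
        tauto
      · have := hr3 (makerMarks σ β (n + 1) ∪ breakerMarks β n) (makerMove σ β n) (hm n).1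
          (Finset.mem_biUnion.2 ⟨v, hv, hw⟩)
        have e := hβ n
        rw [← e] at this
        simp only [makerMarks, Finset.mem_union] at this
        tauto
  refine ⟨makerMove σ β, makerMarks σ β n, hP, fun n => (hm n).1, ?_, ?_⟩
  · intro i j v hi hj
    rcases lt_trichotomy i j with h | h | h
    · exact absurd hj (hdis i j v h hi)
    · exact h
    · exact absurd hi (hdis j i v h hj)
  · clear hP
    induction n with
    | zero => intro v w hv; simp [makerMarks] at hv
    | succ n ih =>
      intro v w hv hw hvw
      simp only [makerMarks, Finset.mem_union] at hv hw
      rcases hv with hv | hv <;> rcases hw with hw | hw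
      · exact ih v w hv hw hvw
      · exact absurd (hclosed n v hv hvw) (Finset.disjoint_left.1 (hm n).2 hw)
      · exact absurd (hclosed n w hw (hs _ _ hvw)) (Finset.disjoint_left.1 (hm n).2 hv)
      · exact ⟨n, hv, hw⟩

lemma lose_26 : ¬ IsWinner T31 2 6 := by
  intro hw
  obtain ⟨m, M, hP, hc, hd, hk⟩ := loser_core 2 6 3 (by norm_num) triNbr
    (by intro v; unfold triNbr; split_ifs <;> exact Finset.card_le_three)
    (by
      rintro ⟨x, y, u⟩ w h
      fin_cases u <;> simp [triNbr] at h <;> rcases h with rfl | rfl | rfl <;> simp [triNbr]) hw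
  obtain ⟨c, p, q, h1, h2, h3, hne, hp, hq⟩ := hasT31_elim hP
  obtain ⟨i, hi, hi'⟩ := hk c p h1 h2 hp
  obtain ⟨j, hj, hj'⟩ := hk c q h1 h3 hq
  obtain rfl := hd i j c hi hj
  have hcn : ∀ v w, w ∈ triNbr v → v ≠ w := by
    rintro ⟨x, y, u⟩ w h
    fin_cases u <;> simp [triNbr] at h <;> rcases h with rfl | rfl | rfl <;> simp
  have : ({c, p, q} : Finset TriCell) ⊆ m i := by
    intro z hz
    simp at hz
    rcases hz with rfl | rfl | rfl <;> assumption
  have := Finset.card_le_card this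
  rw [hc, Finset.card_eq_three.2 ⟨c, p, q, hcn _ _ hp, hcn _ _ hq, hne, rfl⟩] at this
  omega

lemma lose_12 : ¬ IsWinner T31 1 2 := by
  intro hw
  obtain ⟨m, M, hP, hc, hd, hk⟩ := loser_core 1 2 2 (by norm_num) triNbr2
    (by intro v; unfold triNbr2; split_ifs <;> exact Finset.card_le_two)
    (by
      rintro ⟨x, y, u⟩ w h
      fin_cases u <;> simp [triNbr2] at h <;> rcases h with rfl | rfl <;> simp [triNbr2]) hw
  obtain ⟨c, p, q, h1, h2, h3, hne, hp, hq⟩ := hasT31_elim hP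
  have hcn : ∀ v w, w ∈ triNbr2 v → v ≠ w := by
    rintro ⟨x, y, u⟩ w h
    fin_cases u <;> simp [triNbr2] at h <;> rcases h with rfl | rfl <;> simp
  have hno : ∀ w ∈ M, w ∉ triNbr2 c := by
    intro w hwM hwc
    obtain ⟨k, a1, a2⟩ := hk c w h1 hwM hwc
    exact hcn _ _ hwc (Finset.card_le_one.1 (hc k).le _ a1 _ a2)
  have n1 := hno p h2
  have n2 := hno q h3
  obtain ⟨x, y, u⟩ := c
  clear hno h1 hk
  fin_cases u <;> simp [triNbr, triNbr2] at hp hq n1 n2 <;> apply hne <;>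
    rw [show p = _ from by tauto, show q = _ from by tauto]

theorem T31_threshold :
    IsWinner T31 1 1 ∧ ¬ IsWinner T31 1 2 ∧
    IsWinner T31 2 5 ∧ ¬ IsWinner T31 2 6 ∧
    ∀ n b : ℕ, 3 ≤ n → IsWinner T31 n b :=
  ⟨win_11, lose_12, win_25, lose_26, fun n b h => win_n n b h⟩
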